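/- (Derivative of the optimal value function) Let P be the entrywise projection onto a set of index pairs, I ⊆ (0,∞) an open interval, and W ∈ ℝ^{n×n}. Let E : I → ℝ^{n×n} be differentiable with ‖E(ε)‖_F = 1 and (Id − P)(ε E(ε)) = −(Id − P)W for all ε ∈ I, and let G : I → ℝ^{n×n} satisfy P E(ε) ≠ 0, P G(ε) ≠ 0 and the alignment condition P G(ε)/‖P G(ε)‖ = ± P E(ε)/‖P E(ε)‖ for all ε ∈ I. Suppose f : I → ℝ is differentiable with f′(ε) = ⟨P G(ε), P E(ε) + ε P E′(ε)⟩ and f′(ε) ≤ 0 for all ε ∈ I. Then f′(ε) = −‖P G(ε)‖ · ‖P E(ε)‖ − (1/ε²) · (‖P G(ε)‖ / ‖P E(ε)‖) · ‖(Id − P)W‖². -/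

import Mathlib

open Matrix BigOperators

/-- The Frobenius inner product `⟨X, Y⟩ = trace(Xᵀ Y)`. -/
noncomputable def finner {n : ℕ} (X Y : Matrix (Fin n) (Fin n) ℝ) : ℝ :=
  (Xᵀ * Y).trace

/-- The Frobenius norm. -/
noncomputable def frobNorm {n : ℕ} (A : Matrix (Fin n) (Fin n) ℝ) : ℝ :=
  Real.sqrt (finner A A)

/-- The entrywise projection onto the sparsity pattern `S`. -/
noncomputable def proj {n : ℕ} (S : Set (Fin n × Fin n)) (A : Matrix (Fin n) (Fin n) ℝ) :
    Matrix (Fin n) (Fin n) ℝ :=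
  Matrix.of fun i j => S.indicator (fun p => A p.1 p.2) (i, j)

lemma finner_eq_sum {n : ℕ} (X Y : Matrix (Fin n) (Fin n) ℝ) :
    finner X Y = ∑ i, ∑ j, X i j * Y i j := by
  simp only [finner, Matrix.trace, Matrix.diag, Matrix.mul_apply, Matrix.transpose_apply]
  exact Finset.sum_comm

lemma finner_smul_left {n : ℕ} (c : ℝ) (X Y : Matrix (Fin n) (Fin n) ℝ) :
    finner (c • X) Y = c * finner X Y := by
  simp [finner]

lemma finner_smul_right {n : ℕ} (c : ℝ) (X Y : Matrix (Fin n) (Fin n) ℝ) :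
    finner X (c • Y) = c * finner X Y := by
  simp [finner]

lemma finner_add_right {n : ℕ} (X Y Z : Matrix (Fin n) (Fin n) ℝ) :
    finner X (Y + Z) = finner X Y + finner X Z := by
  simp [finner, Matrix.mul_add]

lemma finner_self_nonneg {n : ℕ} (X : Matrix (Fin n) (Fin n) ℝ) : 0 ≤ finner X X := by
  rw [finner_eq_sum]
  exact Finset.sum_nonneg fun i _ => Finset.sum_nonneg fun j _ => mul_self_nonneg _

lemma finner_self_pos {n : ℕ} {X : Matrix (Fin n) (Fin n) ℝ} (hX : X ≠ 0) :
    0 < finner X X := by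
  refine lt_of_le_of_ne (finner_self_nonneg X) fun h => hX ?_
  rw [finner_eq_sum] at h
  ext i j
  have hi := (Finset.sum_eq_zero_iff_of_nonneg
    fun i _ => Finset.sum_nonneg fun j _ => mul_self_nonneg (X i j)).mp h.symm i
    (Finset.mem_univ i)
  have hij := (Finset.sum_eq_zero_iff_of_nonneg
    fun j _ => mul_self_nonneg (X i j)).mp hi j (Finset.mem_univ j)
  exact mul_self_eq_zero.mp hij

lemma frobNorm_sq {n : ℕ} (X : Matrix (Fin n) (Fin n) ℝ) : frobNorm X ^ 2 = finner X X :=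
  Real.sq_sqrt (finner_self_nonneg X)

lemma frobNorm_pos {n : ℕ} {X : Matrix (Fin n) (Fin n) ℝ} (hX : X ≠ 0) : 0 < frobNorm X :=
  Real.sqrt_pos.mpr (finner_self_pos hX)

lemma proj_smul {n : ℕ} (S : Set (Fin n × Fin n)) (c : ℝ) (A : Matrix (Fin n) (Fin n) ℝ) :
    proj S (c • A) = c • proj S A := by
  ext i j
  by_cases h : (i, j) ∈ S <;> simp [proj, h]

lemma finner_self_eq_proj_add_compl {n : ℕ} (S : Set (Fin n × Fin n))
    (A : Matrix (Fin n) (Fin n) ℝ) :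
    finner A A = finner (proj S A) (proj S A) + finner (A - proj S A) (A - proj S A) := by
  simp only [finner_eq_sum, ← Finset.sum_add_distrib]
  refine Finset.sum_congr rfl fun i _ => Finset.sum_congr rfl fun j _ => ?_
  by_cases h : (i, j) ∈ S <;> simp [proj, h]

lemma hasDerivAt_finner_self {n : ℕ} {A : ℝ → Matrix (Fin n) (Fin n) ℝ}
    {A' : Matrix (Fin n) (Fin n) ℝ} {x : ℝ}
    (hA : ∀ i j, HasDerivAt (fun s => A s i j) (A' i j) x) :
    HasDerivAt (fun s => finner (A s) (A s)) (2 * finner (A x) A') x := by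
  simp only [finner_eq_sum, Finset.mul_sum]
  refine HasDerivAt.fun_sum fun i _ => HasDerivAt.fun_sum fun j _ => ?_
  exact ((hA i j).fun_mul (hA i j)).congr_deriv (by ring)

lemma hasDerivAt_proj_apply {n : ℕ} (S : Set (Fin n × Fin n))
    {A : ℝ → Matrix (Fin n) (Fin n) ℝ} {A' : Matrix (Fin n) (Fin n) ℝ} {x : ℝ}
    (hA : ∀ i j, HasDerivAt (fun s => A s i j) (A' i j) x) (i j : Fin n) :
    HasDerivAt (fun s => proj S (A s) i j) (proj S A' i j) x := by
  by_cases h : (i, j) ∈ S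
  · simpa [proj, h] using hA i j
  · simpa [proj, h] using hasDerivAt_const x (0 : ℝ)

/-- **derivative of the optimal value function.** Under unit Frobenius norm of
`E(ε)`, the constancy `(Id - P)(ε E(ε)) = -(Id - P) W`, and the alignment of `P G(ε)` with
`P E(ε)`, any differentiable `f` with `f'(ε) = ⟨P G(ε), P E(ε) + ε P E'(ε)⟩ ≤ 0` satisfies
`f'(ε) = -‖P G(ε)‖ ‖P E(ε)‖ - (1/ε²) (‖P G(ε)‖/‖P E(ε)‖) ‖(Id - P) W‖²`. -/
theorem derivative_of_optimal_value {n : ℕ}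
    (S : Set (Fin n × Fin n)) (I : Set ℝ) (hIopen : IsOpen I)
    (hIpos : I ⊆ Set.Ioi (0 : ℝ)) (hIinterval : I.OrdConnected)
    (W : Matrix (Fin n) (Fin n) ℝ)
    (E E' G : ℝ → Matrix (Fin n) (Fin n) ℝ)
    (hE' : ∀ ε ∈ I, ∀ i j, HasDerivAt (fun s => E s i j) (E' ε i j) ε)
    (hnorm : ∀ ε ∈ I, frobNorm (E ε) = 1)
    (hR : ∀ ε ∈ I, ε • E ε - proj S (ε • E ε) = -(W - proj S W))
    (hPE : ∀ ε ∈ I, proj S (E ε) ≠ 0)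
    (hPG : ∀ ε ∈ I, proj S (G ε) ≠ 0)
    (halign : ∀ ε ∈ I, ∃ s : ℝ, (s = 1 ∨ s = -1) ∧
      proj S (G ε) =
        (s * (frobNorm (proj S (G ε)) / frobNorm (proj S (E ε)))) • proj S (E ε))
    (f f' : ℝ → ℝ)
    (hf : ∀ ε ∈ I, HasDerivAt f (f' ε) ε)
    (hf' : ∀ ε ∈ I, f' ε = finner (proj S (G ε)) (proj S (E ε) + ε • proj S (E' ε)))
    (hf'neg : ∀ ε ∈ I, f' ε ≤ 0) :
    ∀ ε ∈ I, f' ε =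
      -(frobNorm (proj S (G ε)) * frobNorm (proj S (E ε))) -
        (1 / ε ^ 2) * (frobNorm (proj S (G ε)) / frobNorm (proj S (E ε))) *
          frobNorm (W - proj S W) ^ 2 := by
  intro ε hε
  have hpos : 0 < ε := hIpos hε
  set c := frobNorm (W - proj S W) ^ 2 with hc
  have hval : ∀ s ∈ I, finner (proj S (E s)) (proj S (E s)) = 1 - c / s ^ 2 := by
    intro s hs
    have hs0 : 0 < s := hIpos hs
    have hunit : finner (E s) (E s) = 1 := by rw [← frobNorm_sq, hnorm s hs, one_pow]
    have hcompl : s ^ 2 * finner (E s - proj S (E s)) (E s - proj S (E s)) = c := by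
      have h := hR s hs
      rw [proj_smul, ← smul_sub] at h
      rw [hc, frobNorm_sq, ← neg_eq_iff_eq_neg.mpr h, ← neg_smul,
        finner_smul_left, finner_smul_right]
      ring
    have hsplit := finner_self_eq_proj_add_compl S (E s)
    rw [← hcompl, mul_div_cancel_left₀ _ (by positivity)]
    linarith
  have hderiv : finner (proj S (E ε)) (proj S (E' ε)) = c / ε ^ 3 := by
    have h₁ := hasDerivAt_finner_self (hasDerivAt_proj_apply S (hE' ε hε))
    have h₂ : HasDerivAt (fun s : ℝ => 1 - c / s ^ 2) (2 * (c / ε ^ 3)) ε := by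
      refine (((hasDerivAt_const ε c).fun_div (hasDerivAt_pow 2 ε)
        (by positivity)).const_sub 1).congr_deriv ?_
      field_simp
      ring
    have h₃ := h₂.congr_of_eventuallyEq
      (Filter.eventually_of_mem (hIopen.mem_nhds hε) hval)
    linarith [h₁.unique h₃]
  obtain ⟨σ, hσ, hG⟩ := halign ε hε
  have hp := frobNorm_pos (hPE ε hε)
  have hg := frobNorm_pos (hPG ε hε)
  have hf'ε : f' ε = σ * (frobNorm (proj S (G ε)) / frobNorm (proj S (E ε)) *
      (frobNorm (proj S (E ε)) ^ 2 + c / ε ^ 2)) := by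
    rw [hf' ε hε]
    nth_rewrite 1 [hG]
    rw [finner_smul_left, finner_add_right, finner_smul_right, hderiv, ← frobNorm_sq]
    field_simp
  have hc0 : 0 ≤ c := sq_nonneg _
  rcases hσ with rfl | rfl
  · have hneg := hf'neg ε hε
    have : 0 < f' ε := by rw [hf'ε]; positivity
    linarith
  · rw [hf'ε]
    field_simp
    ring
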